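/- Let p ∈ ℂ^d, let K_0 ⊂ ℂ^d be a compact absolutely convex neighbourhood of 0, and set K := p + K_0. Let w ∈ K with r_w := |w−p|_{K_0} < 1 and let n ∈ ℤ_{≥0}. Then ‖e_w − π_{p,n}e_w‖_{exp,K} ≤ ( e^{(1+r_w)·|p|_{K_0°}} / (√(2π)·(1−r_w)) )·√(n+1)·r_w^{n+1}. -/

import Mathlib

open MeasureTheory Complex Filter Matrix
open scoped BigOperators ENNReal Topology

noncomputable section

namespace PFA

/-- The canonical inclusion of `ℝ^d` into `ℂ^d`. -/
def cpx {d : ℕ} (x : Fin d → ℝ) : Fin d → ℂ := fun i => (x i : ℂ)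

/-- Euclidean norm on `ℂ^d`. -/
def enorm' {d : ℕ} (z : Fin d → ℂ) : ℝ := Real.sqrt (∑ i, ‖z i‖ ^ 2)

/-- An absolutely convex subset of `ℂ^d`. -/
def AbsConvex {d : ℕ} (K : Set (Fin d → ℂ)) : Prop :=
  ∀ x ∈ K, ∀ y ∈ K, ∀ a b : ℂ, ‖a‖ + ‖b‖ ≤ 1 → a • x + b • y ∈ K

/-- The (topological) support of a Borel measure. -/
def msupport {X : Type*} [TopologicalSpace X] [MeasurableSpace X] (μ : Measure X) : Set X :=
  {x | ∀ U : Set X, IsOpen U → x ∈ U → 0 < μ U}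

/-- translate of a set -/
def transSet {d : ℕ} (p : Fin d → ℂ) (K : Set (Fin d → ℂ)) : Set (Fin d → ℂ) :=
  (fun z => p + z) '' K

/-- multi-indices of degree at most `n` -/
abbrev MIdx (d n : ℕ) := {α : Fin d → ℕ // ∑ i, α i ≤ n}

instance instFintypeMIdx (d n : ℕ) : Fintype (MIdx d n) :=
  Fintype.subtype
    ((Fintype.piFinset fun _ : Fin d => Finset.range (n + 1)).filter fun α => ∑ i, α i ≤ n)
    (by
      intro α
      simp only [Finset.mem_filter, Fintype.mem_piFinset, Finset.mem_range, Nat.lt_succ_iff]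
      exact ⟨fun h => h.2, fun h =>
        ⟨fun i => le_trans (Finset.single_le_sum (fun j _ => Nat.zero_le (α j))
          (Finset.mem_univ i)) h, h⟩⟩)

/-- inclusion of multi-index sets -/
def midxIncl {d m n : ℕ} (h : m ≤ n) (a : MIdx d m) : MIdx d n := ⟨a.1, a.2.trans h⟩

/-- moment matrix `D_n(μ)` -/
def momentMatrix (d n : ℕ) (μ : Measure (Fin d → ℝ)) : Matrix (MIdx d n) (MIdx d n) ℝ :=
  Matrix.of fun a b => ∫ x, ∏ i, x i ^ (a.1 i + b.1 i) ∂μ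

/-- smallest eigenvalue of a real matrix -/
def minEig {ι : Type*} [Fintype ι] (M : Matrix ι ι ℝ) : ℝ :=
  sInf {t : ℝ | ∃ v : ι → ℝ, v ≠ 0 ∧ M.mulVec v = t • v}

/-- ℓ²→ℓ² operator norm of a matrix -/
def matOpNorm {𝕜 : Type*} [RCLike 𝕜] {ι κ : Type*} [Fintype ι] [Fintype κ]
    (M : Matrix ι κ 𝕜) : ℝ :=
  sSup {t : ℝ | ∃ v : κ → 𝕜, (∑ j, ‖v j‖ ^ 2) ≤ 1 ∧
    t = Real.sqrt (∑ i, ‖∑ j, M i j * v j‖ ^ 2)}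

/-- Frobenius norm of a matrix -/
def matFrobNorm {𝕜 : Type*} [RCLike 𝕜] {ι κ : Type*} [Fintype ι] [Fintype κ]
    (M : Matrix ι κ 𝕜) : ℝ :=
  Real.sqrt (∑ i, ∑ j, ‖M i j‖ ^ 2)

/-- the four Penrose conditions characterizing the Moore–Penrose pseudo-inverse -/
def IsMoorePenrose {ι κ : Type*} [Fintype ι] [Fintype κ]
    (A : Matrix ι κ ℂ) (X : Matrix κ ι ℂ) : Prop :=
  A * X * A = A ∧ X * A * X = X ∧ (A * X)ᴴ = A * X ∧ (X * A)ᴴ = X * A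

/-- complex partial derivative in the `k`-th coordinate -/
def pderivAt {d : ℕ} (k : Fin d) (g : (Fin d → ℂ) → ℂ) : (Fin d → ℂ) → ℂ :=
  fun z => fderiv ℂ g z (Pi.single k 1)

/-- iterated complex partial derivative `∂^γ` -/
def mpderiv {d : ℕ} (γ : Fin d → ℕ) (g : (Fin d → ℂ) → ℂ) : (Fin d → ℂ) → ℂ :=
  ((List.finRange d).map fun k => (pderivAt k)^[γ k]).foldr (fun F h => F h) g

/-- the jet functional `ν_{q,κ}` -/
def jetFun {d : ℕ} (q : Fin d → ℂ) (κ : Fin d → ℕ) (h : (Fin d → ℂ) → ℂ) : ℂ :=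
  ((Real.exp (-(∑ i, ‖q i‖ ^ 2) / 2) / Real.sqrt (∏ i, (κ i).factorial) : ℝ) : ℂ) *
    ∑ γ ∈ Fintype.piFinset fun i => Finset.range (κ i + 1),
      (∏ i, ((κ i).choose (γ i) : ℂ)) *
        (∏ i, (-(starRingEnd ℂ) (q i)) ^ (κ i - γ i)) * mpderiv γ h q

/-- the functions `u_{p,α}` (also used for `v_{q,β}`) -/
def uFn {d : ℕ} (p : Fin d → ℂ) (α : Fin d → ℕ) (z : Fin d → ℂ) : ℂ :=
  ((Real.exp (-(∑ i, ‖p i‖ ^ 2) / 2) / Real.sqrt (∏ i, (α i).factorial) : ℝ) : ℂ) *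
    (∏ i, (z i - p i) ^ (α i)) * Complex.exp (∑ i, z i * (starRingEnd ℂ) (p i))

/-- sample matrix `U_{p,n,Z}` (resp. `V_{q,n,W}`) -/
def sampMat {d N : ℕ} (n : ℕ) (p : Fin d → ℂ) (Z : Fin N → Fin d → ℂ) :
    Matrix (Fin N) (MIdx d n) ℂ :=
  Matrix.of fun i a => uFn p a.1 (Z i)

/-- Data matrix `Ĉ_{m,n,Z}`, given a Moore–Penrose pseudo-inverse `X` of `U_{p,n,Z}ᴴ`:
the leftmost block of `V_{q,m,W}ᴴ * X`. -/
def dataMat {d r N : ℕ} {m n : ℕ} (hmn : m ≤ n) (q : Fin r → ℂ)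
    (W : Fin N → Fin r → ℂ) (X : Matrix (Fin N) (MIdx d n) ℂ) :
    Matrix (MIdx r m) (MIdx d m) ℂ :=
  ((sampMat m q W)ᴴ * X).submatrix id (midxIncl hmn)

/-- jet representation matrix of the push-forward of `f` at `p` -/
def IsJetMatrix {d r : ℕ} (m : ℕ) (p : Fin d → ℂ) (f : (Fin d → ℂ) → Fin r → ℂ)
    (C : Matrix (MIdx r m) (MIdx d m) ℂ) : Prop :=
  ∀ h : MvPolynomial (Fin r) ℂ, ∀ a : MIdx d m,
    jetFun p a.1 (fun z => MvPolynomial.eval (f z) h) =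
      ∑ b : MIdx r m, C b a * jetFun (f p) b.1 (fun w => MvPolynomial.eval w h)

/-- `π^{-d}` times Lebesgue measure on `ℂ^d` -/
def μE (d : ℕ) : Measure (Fin d → ℂ) := ((ENNReal.ofReal Real.pi) ^ d)⁻¹ • volume

/-- `e_w(z) = exp⟨z,w⟩` -/
def eW {d : ℕ} (w : Fin d → ℂ) (z : Fin d → ℂ) : ℂ :=
  Complex.exp (∑ i, z i * (starRingEnd ℂ) (w i))

/-- supporting function `h_K` -/
def suppFn {d : ℕ} (K : Set (Fin d → ℂ)) (ζ : Fin d → ℂ) : ℝ :=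
  sSup ((fun z => (∑ i, ζ i * (starRingEnd ℂ) (z i)).re) '' K)

/-- polar set `K°` -/
def polarSet {d : ℕ} (K : Set (Fin d → ℂ)) : Set (Fin d → ℂ) :=
  {z | ∀ w ∈ K, ‖∑ i, z i * (starRingEnd ℂ) (w i)‖ ≤ 1}

/-- membership in the Fock space -/
def MemFock {d : ℕ} (h : (Fin d → ℂ) → ℂ) : Prop :=
  Differentiable ℂ h ∧
    Integrable (fun z => ‖h z‖ ^ 2 * Real.exp (-(∑ i, ‖z i‖ ^ 2))) (μE d)

/-- Fock-space inner product -/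
def fockInner {d : ℕ} (h g : (Fin d → ℂ) → ℂ) : ℂ :=
  ∫ z, h z * (starRingEnd ℂ) (g z) * ((Real.exp (-(∑ i, ‖z i‖ ^ 2)) : ℝ) : ℂ) ∂(μE d)

/-- orthogonal projection onto `span{u_{p,α} : |α| ≤ n}`, written out using the
orthonormal system `u_{p,α}` -/
def jetProj {d : ℕ} (n : ℕ) (p : Fin d → ℂ) (g : (Fin d → ℂ) → ℂ) : (Fin d → ℂ) → ℂ :=
  fun z => ∑ a : MIdx d n, fockInner g (uFn p a.1) * uFn p a.1 z


lemma circ_aux (k : ℕ) (c : ℂ) (r : ℝ) (hr : 0 < r) :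
    ∫ θ in Set.Ioo (-Real.pi) Real.pi,
      (starRingEnd ℂ) (circleMap 0 r θ) ^ k * Complex.exp (c * circleMap 0 r θ) =
    2 * Real.pi * r ^ (2 * k) * c ^ k / k.factorial := by
  rw [← integral_Ioc_eq_integral_Ioo, ← intervalIntegral.integral_of_le (by linarith [Real.pi_pos])]
  have hper : Function.Periodic (fun θ : ℝ => (starRingEnd ℂ) (circleMap 0 r θ) ^ k *
      Complex.exp (c * circleMap 0 r θ)) (2 * Real.pi) := by
    intro θ
    simp only [periodic_circleMap 0 r θ]
  have h1 := hper.intervalIntegral_add_eq (-Real.pi) 0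
  rw [show -Real.pi + 2 * Real.pi = Real.pi by ring, zero_add] at h1
  rw [h1]
  have hd : DifferentiableOn ℂ (fun z => Complex.exp (c * z)) (Metric.closedBall 0 r) := by
    fun_prop
  have h2 := (DifferentiableOn.circleIntegral_one_div_sub_center_pow_smul hr k hd)
  rw [iteratedDeriv_cexp_const_mul] at h2
  simp only [circleIntegral, deriv_circleMap, smul_eq_mul, sub_zero, mul_zero, Complex.exp_zero,
    mul_one] at h2
  have h3 : ∀ θ : ℝ, (starRingEnd ℂ) (circleMap 0 r θ) ^ k * Complex.exp (c * circleMap 0 r θ) =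
      ((r : ℂ) ^ (2 * k) / I) * (circleMap 0 r θ * I *
        (1 / circleMap 0 r θ ^ (k + 1) * Complex.exp (c * circleMap 0 r θ))) := by
    intro θ
    have hne : circleMap 0 r θ ≠ 0 := circleMap_ne_center hr.ne'
    have h4 : (starRingEnd ℂ) (circleMap 0 r θ) * circleMap 0 r θ = (r : ℂ) ^ 2 := by
      rw [mul_comm, Complex.mul_conj, Complex.normSq_eq_norm_sq]
      simp
    rw [pow_mul, ← h4, mul_pow]
    field_simp [I_ne_zero]
    ring
  simp_rw [h3]
  rw [intervalIntegral.integral_const_mul, h2]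
  field_simp [I_ne_zero]

lemma radial_aux (k : ℕ) :
    ∫ r in Set.Ioi (0 : ℝ), r ^ (2 * k + 1) * Real.exp (-r ^ 2) = (k.factorial : ℝ) / 2 := by
  have h := _root_.integral_rpow_mul_exp_neg_rpow (p := 2) (q := 2 * k + 1) (by norm_num) (by
    have : (0 : ℝ) ≤ k := by positivity
    linarith)
  rw [show ((2 * (k : ℝ) + 1 + 1) / 2) = k + 1 by ring, Real.Gamma_nat_eq_factorial] at h
  rw [show (k.factorial : ℝ) / 2 = 1 / 2 * k.factorial by ring, ← h]
  refine setIntegral_congr_fun measurableSet_Ioi fun x hx => ?_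
  congr 1
  · rw [← Real.rpow_natCast]; push_cast; rfl
  · norm_num

lemma gauss_aux (k : ℕ) (c : ℂ) :
    ∫ u : ℂ, (starRingEnd ℂ) u ^ k * Complex.exp (c * u) * ((Real.exp (-‖u‖ ^ 2) : ℝ) : ℂ) =
      Real.pi * c ^ k := by
  rw [← Complex.integral_comp_polarCoord_symm, polarCoord_target]
  have hcm : ∀ q : ℝ × ℝ, Complex.polarCoord.symm q = circleMap 0 q.1 q.2 := by
    intro q
    rw [Complex.polarCoord_symm_apply, circleMap, Complex.exp_mul_I]
    simp
  simp_rw [hcm]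
  rw [Measure.volume_eq_prod, setIntegral_prod]
  · have : ∀ r ∈ Set.Ioi (0 : ℝ), (∫ θ in Set.Ioo (-Real.pi) Real.pi,
        r • ((starRingEnd ℂ) (circleMap 0 r θ) ^ k * Complex.exp (c * circleMap 0 r θ) *
          ((Real.exp (-‖circleMap 0 r θ‖ ^ 2) : ℝ) : ℂ))) =
        (2 * Real.pi * c ^ k / k.factorial) * ((r ^ (2 * k + 1) * Real.exp (-r ^ 2) : ℝ) : ℂ) := by
      intro r hr
      simp only [norm_circleMap_zero, sq_abs, real_smul]
      rw [integral_const_mul, integral_mul_const, circ_aux k c r hr]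
      push_cast
      ring
    simp only
    rw [setIntegral_congr_fun measurableSet_Ioi this, integral_const_mul]
    have h := radial_aux k
    rw [integral_complex_ofReal, h]
    have : (k.factorial : ℂ) ≠ 0 := by exact_mod_cast k.factorial_ne_zero
    push_cast
    field_simp
  · have hg : IntegrableOn (fun r : ℝ => r ^ (k + 1) * Real.exp (-(1/2) * r ^ 2)) (Set.Ioi 0) := by
      have h := integrableOn_rpow_mul_exp_neg_mul_sq (b := 1/2) (by norm_num) (s := (k + 1 : ℕ))
        (by have : (0 : ℝ) ≤ (k+1 : ℕ) := by positivity
            linarith)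
      simpa only [Real.rpow_natCast] using h
    have hg2 := (hg.const_mul (Real.exp (‖c‖ ^ 2 / 2)))
    have h1 : IntegrableOn (fun _ : ℝ => (1 : ℝ)) (Set.Ioo (-Real.pi) Real.pi) := by
      simp
    have hp := hg2.mul_prod h1
    rw [Measure.prod_restrict] at hp
    refine Integrable.mono' hp ?_ ?_
    · refine Continuous.aestronglyMeasurable ?_
      unfold circleMap
      fun_prop
    · refine (ae_restrict_iff' (measurableSet_Ioi.prod measurableSet_Ioo)).2 (ae_of_all _ ?_)
      rintro ⟨r, θ⟩ ⟨hr, -⟩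
      simp only [Set.mem_Ioi] at hr
      have e1 : ‖Complex.exp (c * circleMap 0 r θ)‖ ≤ Real.exp (‖c‖ * r) := by
        refine (Complex.norm_exp_le_exp_norm _).trans ?_
        rw [norm_mul, norm_circleMap_zero, abs_of_pos hr]
      simp only [norm_smul, norm_mul, norm_pow, RCLike.norm_conj, norm_circleMap_zero, sq_abs,
        Complex.norm_real, Real.norm_eq_abs, Real.abs_exp, abs_of_pos hr, mul_one]
      calc r * (r ^ k * ‖Complex.exp (c * circleMap 0 r θ)‖ * Real.exp (-r ^ 2))
          ≤ r * (r ^ k * Real.exp (‖c‖ * r) * Real.exp (-r ^ 2)) := by gcongr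
        _ = r ^ (k+1) * Real.exp (‖c‖ * r - r^2) := by
            rw [sub_eq_add_neg, Real.exp_add]; ring
        _ ≤ r ^ (k+1) * Real.exp (‖c‖ ^ 2 / 2 + (-(1/2) * r ^ 2)) := by
            gcongr
            nlinarith [sq_nonneg (‖c‖ - r)]
        _ = _ := by rw [Real.exp_add]; ring

lemma gauss1 (k : ℕ) (p w : ℂ) :
    ∫ z : ℂ, Complex.exp (z * (starRingEnd ℂ) w) * (starRingEnd ℂ) ((z - p) ^ k *
      Complex.exp (z * (starRingEnd ℂ) p)) * ((Real.exp (-‖z‖ ^ 2) : ℝ) : ℂ) =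
      Real.pi * (starRingEnd ℂ) ((w - p) ^ k * Complex.exp (w * (starRingEnd ℂ) p)) := by
  rw [← integral_add_right_eq_self _ p]
  have key : ∀ u : ℂ, Complex.exp ((u + p) * (starRingEnd ℂ) w) * (starRingEnd ℂ) ((u + p - p) ^ k *
      Complex.exp ((u + p) * (starRingEnd ℂ) p)) * ((Real.exp (-‖u + p‖ ^ 2) : ℝ) : ℂ) =
      Complex.exp (p * (starRingEnd ℂ) w) * ((starRingEnd ℂ) u ^ k *
        Complex.exp ((starRingEnd ℂ) (w - p) * u) * ((Real.exp (-‖u‖ ^ 2) : ℝ) : ℂ)) := by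
    intro u
    have h : ∀ z : ℂ, ((Real.exp (-‖z‖ ^ 2) : ℝ) : ℂ) =
        Complex.exp (-(z * (starRingEnd ℂ) z)) := by
      intro z
      rw [Complex.mul_conj, Complex.normSq_eq_norm_sq]; push_cast; rfl
    rw [h, h, map_mul, ← Complex.exp_conj, add_sub_cancel_right, map_pow]
    have : ∀ a b c d e f : ℂ, ∀ x : ℂ, a + b + c = d + e + f →
        Complex.exp a * (x * Complex.exp b) * Complex.exp c =
        Complex.exp d * (x * Complex.exp e * Complex.exp f) := by
      intro a b c d e f x hx
      have := congrArg Complex.exp hx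
      simp only [Complex.exp_add] at this
      linear_combination x * this
    apply this
    simp only [map_mul, map_add, map_sub, Complex.conj_conj]
    ring
  simp_rw [key]
  rw [integral_const_mul, gauss_aux, map_mul, ← Complex.exp_conj, map_mul, Complex.conj_conj,
    map_pow, mul_comm p]
  ring

lemma fock_eW (d : ℕ) (p w : Fin d → ℂ) (α : Fin d → ℕ) :
    fockInner (eW w) (uFn p α) = (starRingEnd ℂ) (uFn p α w) := by
  unfold fockInner μE eW uFn
  rw [integral_smul_measure]
  set C : ℝ := Real.exp (-(∑ i, ‖p i‖ ^ 2) / 2) / Real.sqrt (∏ i, (α i).factorial) with hC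
  have h : ∀ z : Fin d → ℂ, Complex.exp (∑ i, z i * (starRingEnd ℂ) (w i)) *
      (starRingEnd ℂ) ((C : ℂ) * (∏ i, (z i - p i) ^ (α i)) *
        Complex.exp (∑ i, z i * (starRingEnd ℂ) (p i))) *
        ((Real.exp (-(∑ i, ‖z i‖ ^ 2)) : ℝ) : ℂ) =
      (C : ℂ) * ∏ i, (Complex.exp (z i * (starRingEnd ℂ) (w i)) *
        (starRingEnd ℂ) ((z i - p i) ^ (α i) *
          Complex.exp (z i * (starRingEnd ℂ) (p i))) * ((Real.exp (-‖z i‖ ^ 2) : ℝ) : ℂ)) := by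
    intro z
    rw [← Finset.sum_neg_distrib, Real.exp_sum, Complex.exp_sum, Complex.exp_sum]
    simp only [map_mul, map_prod, Complex.conj_ofReal, Finset.prod_mul_distrib, Complex.ofReal_prod]
    ring
  simp_rw [h]
  rw [integral_const_mul, integral_fintype_prod_volume_eq_prod (fun i (x : ℂ) =>
    Complex.exp (x * (starRingEnd ℂ) (w i)) * (starRingEnd ℂ) ((x - p i) ^ (α i) *
          Complex.exp (x * (starRingEnd ℂ) (p i))) * ((Real.exp (-‖x‖ ^ 2) : ℝ) : ℂ))]
  simp_rw [gauss1]
  rw [Finset.prod_mul_distrib, Complex.exp_sum]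
  simp only [map_mul, map_prod, Complex.conj_ofReal, Finset.prod_mul_distrib, Finset.prod_const,
    Finset.card_univ, Fintype.card_fin, real_smul, ENNReal.toReal_inv, ENNReal.toReal_pow,
    ENNReal.toReal_ofReal Real.pi_pos.le]
  have : (Real.pi : ℂ) ≠ 0 := by exact_mod_cast Real.pi_ne_zero
  push_cast
  field_simp

lemma sum_midx (d n : ℕ) (x : Fin d → ℂ) :
    ∑ a : MIdx d n, ∏ i, (x i ^ a.1 i / ((a.1 i).factorial : ℂ)) =
      ∑ k ∈ Finset.range (n + 1), (∑ i, x i) ^ k / (k.factorial : ℂ) := by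
  have h1 : ∀ k : ℕ, (∑ i, x i) ^ k / (k.factorial : ℂ) =
      ∑ a ∈ Finset.piAntidiag (Finset.univ : Finset (Fin d)) k,
        ∏ i, (x i ^ a i / ((a i).factorial : ℂ)) := by
    intro k
    rw [Finset.sum_pow_eq_sum_piAntidiag, Finset.sum_div]
    refine Finset.sum_congr rfl fun a ha => ?_
    have hs : ∑ i, a i = k := (Finset.mem_piAntidiag.1 ha).1
    have hm := Nat.multinomial_spec (Finset.univ : Finset (Fin d)) a
    rw [hs] at hm
    rw [← hm, Finset.prod_div_distrib]
    have h2 : (∏ i, ((a i).factorial : ℂ)) ≠ 0 :=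
      Finset.prod_ne_zero_iff.2 fun i _ => by exact_mod_cast (a i).factorial_ne_zero
    have h3 : (Nat.multinomial Finset.univ a : ℂ) ≠ 0 := by
      intro h0
      have h0' : Nat.multinomial Finset.univ a = 0 := by exact_mod_cast h0
      rw [h0', mul_zero] at hm
      exact k.factorial_ne_zero hm.symm
    push_cast
    field_simp
  simp_rw [h1]
  rw [← Finset.sum_biUnion]
  · refine Finset.sum_bij (fun a _ => a.1) ?_ ?_ ?_ ?_
    · intro a _
      simp only [Finset.mem_biUnion, Finset.mem_range, Finset.mem_piAntidiag]
      exact ⟨_, Nat.lt_succ_of_le a.2, rfl, by simp⟩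
    · intro a _ b _ h
      exact Subtype.ext h
    · intro b hb
      simp only [Finset.mem_biUnion, Finset.mem_range, Finset.mem_piAntidiag] at hb
      obtain ⟨k, hk, hs, -⟩ := hb
      exact ⟨⟨b, hs.le.trans (Nat.lt_succ_iff.1 hk)⟩, Finset.mem_univ _, rfl⟩
    · intros; rfl
  · intro i _ j _ hij
    rw [Function.onFun, Finset.disjoint_left]
    intro a ha hb
    exact hij ((Finset.mem_piAntidiag.1 ha).1.symm.trans (Finset.mem_piAntidiag.1 hb).1)

def ip {d : ℕ} (z w : Fin d → ℂ) : ℂ := ∑ i, z i * (starRingEnd ℂ) (w i)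

lemma jetProj_eq (d n : ℕ) (p w ζ : Fin d → ℂ) :
    jetProj n p (eW w) ζ = Complex.exp (ip ζ p + ip p (w - p)) *
      ∑ k ∈ Finset.range (n + 1), ip (ζ - p) (w - p) ^ k / (k.factorial : ℂ) := by
  unfold jetProj
  simp_rw [fock_eW]
  rw [show ip (ζ - p) (w - p) = ∑ i, ((ζ - p) i * (starRingEnd ℂ) ((w - p) i)) from rfl,
    ← sum_midx, Finset.mul_sum]
  refine Finset.sum_congr rfl fun a _ => ?_
  unfold uFn
  set C : ℝ := Real.exp (-(∑ i, ‖p i‖ ^ 2) / 2) / Real.sqrt (∏ i, (a.1 i).factorial) with hC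
  have hCC : (C : ℂ) * C = Complex.exp (-(ip p p)) / ∏ i, ((a.1 i).factorial : ℂ) := by
    have h1 : C * C = Real.exp (-(∑ i, ‖p i‖ ^ 2)) / ∏ i, ((a.1 i).factorial : ℝ) := by
      rw [hC, div_mul_div_comm, ← Real.exp_add, Real.mul_self_sqrt (by positivity)]
      push_cast
      congr 2
      ring
    rw [← Complex.ofReal_mul, h1]
    unfold ip
    push_cast
    congr 3
    refine Finset.sum_congr rfl fun i _ => ?_
    rw [Complex.mul_conj, Complex.normSq_eq_norm_sq]; push_cast; rfl
  have hexp : Complex.exp (ip ζ p + ip p (w - p)) =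
      Complex.exp (-(ip p p)) * Complex.exp (ip ζ p) * (starRingEnd ℂ) (Complex.exp (ip w p)) := by
    rw [← Complex.exp_conj, ← Complex.exp_add, ← Complex.exp_add]
    congr 1
    have : (starRingEnd ℂ) (ip w p) = ip p w := by
      unfold ip
      rw [map_sum]
      refine Finset.sum_congr rfl fun i _ => ?_
      rw [map_mul, Complex.conj_conj, mul_comm]
    rw [this]
    have : ip p (w - p) = ip p w - ip p p := by
      unfold ip
      rw [← Finset.sum_sub_distrib]
      refine Finset.sum_congr rfl fun i _ => ?_
      simp; ring
    rw [this]; ring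
  rw [hexp]
  simp only [map_mul, Complex.conj_ofReal, map_prod, map_pow, Finset.prod_div_distrib, mul_pow,
    Finset.prod_mul_distrib, Pi.sub_apply, map_sub]
  change _ = _ * (((∏ i, (ζ i - p i) ^ a.1 i) *
    ∏ i, ((starRingEnd ℂ) (w i) - (starRingEnd ℂ) (p i)) ^ a.1 i) /
    ∏ i, ((a.1 i).factorial : ℂ))
  simp only [ip] at hCC ⊢
  linear_combination (∏ i, (ζ i - p i) ^ a.1 i) *
    (∏ i, ((starRingEnd ℂ) (w i) - (starRingEnd ℂ) (p i)) ^ a.1 i) *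
    (starRingEnd ℂ) (Complex.exp (∑ i, w i * (starRingEnd ℂ) (p i))) *
    Complex.exp (∑ i, ζ i * (starRingEnd ℂ) (p i)) * hCC

lemma eW_eq (d : ℕ) (p w ζ : Fin d → ℂ) :
    eW w ζ = Complex.exp (ip ζ p + ip p (w - p)) * Complex.exp (ip (ζ - p) (w - p)) := by
  rw [← Complex.exp_add]
  unfold eW ip
  congr 1
  rw [← Finset.sum_add_distrib, ← Finset.sum_add_distrib]
  refine Finset.sum_congr rfl fun i _ => ?_
  simp; ring

/-- scalar tail estimate -/
lemma tail_bound (n : ℕ) (x : ℂ) (r s : ℝ) (hr0 : 0 ≤ r) (hr1 : r < 1) (hs : 0 ≤ s)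
    (hx : ‖x‖ ≤ r * s) :
    ‖Complex.exp x - ∑ k ∈ Finset.range (n + 1), x ^ k / (k.factorial : ℂ)‖ * Real.exp (-s) ≤
      1 / (Real.sqrt (2 * Real.pi) * (1 - r)) * (Real.sqrt (n + 1) * r ^ (n + 1)) := by
  have hsum := NormedSpace.expSeries_div_hasSum_exp (𝔸 := ℂ) x
  rw [← Complex.exp_eq_exp_ℂ] at hsum
  have htail := (hasSum_nat_add_iff' (n + 1)).2 hsum
  rw [← htail.tsum_eq]
  have hgeo := (hasSum_geometric_of_lt_one hr0 hr1).mul_left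
    (r ^ (n + 1) / Real.sqrt (2 * Real.pi) * Real.exp s)
  have hterm : ∀ k : ℕ, ‖x ^ (k + (n + 1)) / ((k + (n + 1)).factorial : ℂ)‖ ≤
      r ^ (n + 1) / Real.sqrt (2 * Real.pi) * Real.exp s * r ^ k := by
    intro k
    set m := k + (n + 1) with hm
    have hm1 : (1 : ℝ) ≤ m := by
      have : 1 ≤ m := by omega
      exact_mod_cast this
    have hmpos : (0 : ℝ) < m := by linarith
    rw [norm_div, norm_pow, Complex.norm_natCast]
    have hst := Stirling.le_factorial_stirling m
    have h1 : Real.sqrt (2 * Real.pi) * (m / Real.exp 1) ^ m ≤ m.factorial := by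
      refine le_trans ?_ hst
      have := Real.pi_pos
      have h5 : 2 * Real.pi ≤ 2 * Real.pi * m := le_mul_of_one_le_right (by positivity) hm1
      exact mul_le_mul_of_nonneg_right (Real.sqrt_le_sqrt h5) (by positivity)
    have h2 : s ^ m ≤ Real.exp s * (m / Real.exp 1) ^ m := by
      have h3 : s / m ≤ Real.exp (s / m - 1) := by
        have := Real.add_one_le_exp (s / m - 1)
        linarith
      have h4 : (s / m) ^ m ≤ Real.exp (s / m - 1) ^ m := by gcongr
      rw [← Real.exp_nat_mul, show (m : ℝ) * (s / m - 1) = s - m by field_simp,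
        Real.exp_sub] at h4
      rw [div_pow, ← Real.exp_nat_mul, mul_one]
      rw [div_pow, div_le_iff₀ (by positivity)] at h4
      calc _ ≤ _ := h4
        _ = _ := by ring
    have hq : 0 < Real.sqrt (2 * Real.pi) := by have := Real.pi_pos; positivity
    rw [div_le_iff₀ (by positivity)]
    calc ‖x‖ ^ m ≤ (r * s) ^ m := by gcongr
      _ = r ^ m * s ^ m := mul_pow _ _ _
      _ ≤ r ^ m * (Real.exp s * (m / Real.exp 1) ^ m) := by gcongr
      _ = r ^ m * Real.exp s / Real.sqrt (2 * Real.pi) *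
          (Real.sqrt (2 * Real.pi) * (m / Real.exp 1) ^ m) := by field_simp
      _ ≤ r ^ m * Real.exp s / Real.sqrt (2 * Real.pi) * m.factorial := by gcongr
      _ = _ := by rw [hm, pow_add]; ring
  have hle := tsum_of_norm_bounded hgeo hterm
  have hq : 0 < Real.sqrt (2 * Real.pi) := by have := Real.pi_pos; positivity
  have h1r : 0 < 1 - r := by linarith
  have hsq : (1 : ℝ) ≤ Real.sqrt (n + 1) := by
    rw [Real.one_le_sqrt]; have : (0:ℝ) ≤ n := by positivity
    linarith
  calc _ ≤ (r ^ (n + 1) / Real.sqrt (2 * Real.pi) * Real.exp s * (1 - r)⁻¹) * Real.exp (-s) := by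
        gcongr
    _ = 1 / (Real.sqrt (2 * Real.pi) * (1 - r)) * (1 * r ^ (n + 1)) := by
        rw [Real.exp_neg]; field_simp
    _ ≤ _ := by gcongr

section supp
variable {d : ℕ} {K : Set (Fin d → ℂ)}

lemma ip_bdd (hK : IsCompact K) (ζ : Fin d → ℂ) :
    BddAbove ((fun z => (∑ i, ζ i * (starRingEnd ℂ) (z i)).re) '' K) := by
  refine (hK.image ?_).bddAbove
  refine Complex.continuous_re.comp (continuous_finsetSum _ fun i _ => ?_)
  exact continuous_const.mul (Complex.continuous_conj.comp (continuous_apply i))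

lemma re_ip_le (hK : IsCompact K) (ζ : Fin d → ℂ) {z : Fin d → ℂ} (hz : z ∈ K) :
    (ip ζ z).re ≤ suppFn K ζ := le_csSup (ip_bdd hK ζ) ⟨z, hz, rfl⟩

lemma ip_smul_right (c : ℂ) (ζ z : Fin d → ℂ) : ip ζ (c • z) = (starRingEnd ℂ) c * ip ζ z := by
  unfold ip
  rw [Finset.mul_sum]
  refine Finset.sum_congr rfl fun i _ => ?_
  simp; ring

lemma ip_rsmul_right (c : ℝ) (ζ z : Fin d → ℂ) : ip ζ (c • z) = c * ip ζ z := by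
  unfold ip
  rw [Finset.mul_sum]
  refine Finset.sum_congr rfl fun i _ => ?_
  simp; ring

lemma ip_rsmul_left (c : ℝ) (ζ z : Fin d → ℂ) : ip (c • ζ) z = c * ip ζ z := by
  unfold ip
  rw [Finset.mul_sum]
  refine Finset.sum_congr rfl fun i _ => ?_
  simp; ring

lemma norm_ip_le (hK : IsCompact K) (hKa : AbsConvex K) (ζ : Fin d → ℂ) {z : Fin d → ℂ}
    (hz : z ∈ K) : ‖ip ζ z‖ ≤ suppFn K ζ := by
  obtain ⟨c, hc, hcz⟩ : ∃ c : ℂ, ‖c‖ ≤ 1 ∧ c * ip ζ z = ‖ip ζ z‖ := by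
    by_cases h : ip ζ z = 0
    · exact ⟨0, by simp, by simp [h]⟩
    · refine ⟨‖ip ζ z‖ / ip ζ z, ?_, ?_⟩
      · rw [norm_div, Complex.norm_real, norm_norm, div_self (norm_ne_zero_iff.2 h)]
      · field_simp
  have hmem : (starRingEnd ℂ) c • z ∈ K := by
    have := hKa z hz z hz ((starRingEnd ℂ) c) 0 (by simpa using hc)
    simpa using this
  have := re_ip_le hK ζ hmem
  rw [ip_smul_right, Complex.conj_conj, hcz, Complex.ofReal_re] at this
  exact this

lemma norm_ip_le_gauge (hK : IsCompact K) (hKa : AbsConvex K) (hKn : K ∈ nhds 0)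
    (ζ v : Fin d → ℂ) : ‖ip ζ v‖ ≤ gauge K v * suppFn K ζ := by
  have h0 : (0 : ℝ) ≤ suppFn K ζ :=
    (norm_nonneg _).trans (norm_ip_le hK hKa ζ (mem_of_mem_nhds hKn))
  have key : ∀ t, gauge K v < t → ‖ip ζ v‖ ≤ t * suppFn K ζ := by
    intro t ht
    obtain ⟨b, hb0, hbt, u, hu, rfl⟩ := exists_lt_of_gauge_lt (absorbent_nhds_zero hKn) ht
    simp only
    rw [ip_rsmul_right, norm_mul, Complex.norm_real, Real.norm_of_nonneg hb0.le]
    have := norm_ip_le hK hKa ζ hu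
    exact mul_le_mul hbt.le this (norm_nonneg _) (hb0.le.trans hbt.le)
  have hc : Tendsto (fun t : ℝ => t * suppFn K ζ) (𝓝[>] (gauge K v)) (𝓝 (gauge K v * suppFn K ζ)) :=
    ((continuous_id.mul continuous_const).tendsto _).mono_left nhdsWithin_le_nhds
  refine ge_of_tendsto hc ?_
  filter_upwards [self_mem_nhdsWithin] with t ht using key t ht

lemma suppFn_le_gauge (hK : IsCompact K) (hKa : AbsConvex K) (hKn : K ∈ nhds 0)
    (p : Fin d → ℂ) : suppFn K p ≤ gauge (polarSet K) p := by
  have h0 : (0 : ℝ) ≤ suppFn K p :=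
    (norm_nonneg _).trans (norm_ip_le hK hKa p (mem_of_mem_nhds hKn))
  unfold gauge
  refine le_csInf ?_ ?_
  · refine ⟨suppFn K p + 1, by linarith,
      (suppFn K p + 1)⁻¹ • p, ?_, ?_⟩
    · intro z hz
      change ‖ip _ z‖ ≤ 1
      rw [ip_rsmul_left, norm_mul, Complex.norm_real, Real.norm_of_nonneg (by positivity),
        inv_mul_le_iff₀ (by positivity)]
      linarith [norm_ip_le hK hKa p hz]
    · simp only
      rw [smul_smul, mul_inv_cancel₀ (by positivity), one_smul]
  · rintro t ⟨ht, u, hu, rfl⟩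
    refine csSup_le ⟨_, 0, mem_of_mem_nhds hKn, rfl⟩ ?_
    rintro _ ⟨z, hz, rfl⟩
    change (ip (t • u) z).re ≤ t
    have h1 : ‖ip u z‖ ≤ 1 := hu z hz
    rw [ip_rsmul_left, Complex.re_ofReal_mul]
    have := Complex.re_le_norm (ip u z)
    nlinarith

lemma suppFn_sub_le (hK : IsCompact K) (hKa : AbsConvex K) (hKn : K ∈ nhds 0)
    (ζ p : Fin d → ℂ) : suppFn K (ζ - p) ≤ suppFn K ζ + suppFn K p := by
  refine csSup_le ⟨_, 0, mem_of_mem_nhds hKn, rfl⟩ ?_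
  rintro _ ⟨z, hz, rfl⟩
  change (ip (ζ - p) z).re ≤ _
  have : ip (ζ - p) z = ip ζ z - ip p z := by
    unfold ip
    rw [← Finset.sum_sub_distrib]
    refine Finset.sum_congr rfl fun i _ => ?_
    simp; ring
  rw [this, Complex.sub_re]
  have h1 := re_ip_le hK ζ hz
  have h2 := norm_ip_le hK hKa p hz
  have h3 := Complex.abs_re_le_norm (ip p z)
  have h4 := neg_abs_le (ip p z).re
  linarith

lemma suppFn_trans (hK : IsCompact K) (hKn : K ∈ nhds 0) (ζ p : Fin d → ℂ) :
    (ip ζ p).re + suppFn K ζ ≤ suppFn (transSet p K) ζ := by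
  have hKt : IsCompact (transSet p K) := hK.image (by fun_prop)
  have : suppFn K ζ ≤ suppFn (transSet p K) ζ - (ip ζ p).re := by
    refine csSup_le ⟨_, 0, mem_of_mem_nhds hKn, rfl⟩ ?_
    rintro _ ⟨z, hz, rfl⟩
    change (ip ζ z).re ≤ _
    have h1 := re_ip_le hKt ζ (z := p + z) ⟨z, hz, rfl⟩
    have : ip ζ (p + z) = ip ζ p + ip ζ z := by
      unfold ip
      rw [← Finset.sum_add_distrib]
      refine Finset.sum_congr rfl fun i _ => ?_
      simp; ring
    rw [this, Complex.add_re] at h1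
    linarith
  linarith

end supp

/-- exp-norm bound for the jet projection of `e_w`. -/
theorem statement13 (d : ℕ) (p : Fin d → ℂ) (K₀ : Set (Fin d → ℂ))
    (hK₀c : IsCompact K₀) (hK₀a : AbsConvex K₀) (hK₀n : K₀ ∈ nhds (0 : Fin d → ℂ))
    (w : Fin d → ℂ) (hw : w ∈ transSet p K₀) (hrw : gauge K₀ (w - p) < 1) (n : ℕ) :
    ∀ ζ : Fin d → ℂ,
      ‖eW w ζ - jetProj n p (eW w) ζ‖ * Real.exp (-(suppFn (transSet p K₀) ζ)) ≤
        Real.exp ((1 + gauge K₀ (w - p)) * gauge (polarSet K₀) p) /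
            (Real.sqrt (2 * Real.pi) * (1 - gauge K₀ (w - p))) *
          (Real.sqrt (n + 1) * gauge K₀ (w - p) ^ (n + 1)) := by
  intro ζ
  set r := gauge K₀ (w - p) with hr
  have hr0 : 0 ≤ r := gauge_nonneg _
  have hpg := suppFn_le_gauge hK₀c hK₀a hK₀n p
  have hsub := suppFn_sub_le hK₀c hK₀a hK₀n ζ p
  have htr := suppFn_trans hK₀c hK₀n ζ p
  have hx := norm_ip_le_gauge hK₀c hK₀a hK₀n (ζ - p) (w - p)
  have hp := norm_ip_le_gauge hK₀c hK₀a hK₀n p (w - p)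
  rw [← hr] at hx hp
  set s := suppFn K₀ (ζ - p) with hs
  have hs0 : 0 ≤ s :=
    (norm_nonneg _).trans (norm_ip_le hK₀c hK₀a (ζ - p) (mem_of_mem_nhds hK₀n))
  have htb := tail_bound n _ r s hr0 hrw hs0 hx
  rw [eW_eq d p, jetProj_eq, ← mul_sub, norm_mul, Complex.norm_exp, Complex.add_re]
  set T := ‖Complex.exp (ip (ζ - p) (w - p)) - ∑ k ∈ Finset.range (n + 1),
    ip (ζ - p) (w - p) ^ k / (k.factorial : ℂ)‖ with hT
  have hT0 : 0 ≤ T := norm_nonneg _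
  set G := gauge (polarSet K₀) p with hG
  have hre := Complex.re_le_norm (ip p (w - p))
  have hrG : r * suppFn K₀ p ≤ r * G := mul_le_mul_of_nonneg_left hpg hr0
  calc Real.exp ((ip ζ p).re + (ip p (w - p)).re) * T *
        Real.exp (-(suppFn (transSet p K₀) ζ))
      = T * Real.exp ((ip ζ p).re + (ip p (w - p)).re - suppFn (transSet p K₀) ζ) := by
        rw [sub_eq_add_neg ((ip ζ p).re + _), Real.exp_add _ (-_)]; ring
    _ ≤ T * Real.exp ((1 + r) * G + -s) := by
        gcongr
        linarith
    _ = Real.exp ((1 + r) * G) * (T * Real.exp (-s)) := by rw [Real.exp_add]; ring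
    _ ≤ Real.exp ((1 + r) * G) * (1 / (Real.sqrt (2 * Real.pi) * (1 - r)) *
          (Real.sqrt (n + 1) * r ^ (n + 1))) := by gcongr
    _ = _ := by ring

end PFA
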